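/- Fix γ ∈ [−4, 0) and a measurable β : (0, π/2] → [0, ∞) with ∫₀^{π/2} θ² β(θ) dθ = 8/π, and for ε ∈ (0, 1] set β^ε(θ) = (π³/ε³) β(πθ/ε) for θ ∈ (0, ε/2]. Let ψ ∈ DS_c^∞. Then, as ε ↓ 0, ∫∫_{ℝ⁶} |v−v∗|^γ ∫₀^{ε/2} β^ε(θ) ∫₀^{2π} |∇̄ψ(v, v∗, σ(θ,φ))|² dφ dθ dv∗ dv converges to 8 ∫∫_{ℝ⁶} |v−v∗|^{2+γ} |Π[v−v∗] ((∇_v − ∇_{v∗})ψ)(v,v∗)|² dv∗ dv. -/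

import Mathlib

noncomputable section
open Real MeasureTheory Filter Topology
open scoped RealInnerProductSpace

abbrev E3 : Type := EuclideanSpace ℝ (Fin 3)

/-- Post-collision velocity `v' = (v+v∗)/2 + (|v−v∗|/2)σ`. -/
def vPost (v w σ : E3) : E3 := ((2 : ℝ)⁻¹) • (v + w) + (‖v - w‖ / 2) • σ

/-- Post-collision velocity `v∗' = (v+v∗)/2 − (|v−v∗|/2)σ`. -/
def vPostStar (v w σ : E3) : E3 := ((2 : ℝ)⁻¹) • (v + w) - (‖v - w‖ / 2) • σ

/-- Collision direction `σ(θ,φ) = cos θ·k + sin θ·(cos φ·h + sin φ·i)`. -/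
def sigmaDir (k h i : E3) (θ φ : ℝ) : E3 :=
  Real.cos θ • k + Real.sin θ • (Real.cos φ • h + Real.sin φ • i)

/-- Unit vector `k = (v − v∗)/|v − v∗|`. -/
def unitK (v w : E3) : E3 := ‖v - w‖⁻¹ • (v - w)

/-- Orthogonal projection `Π[z]u = u − ⟨z,u⟩z/|z|²` onto the plane orthogonal to `z`. -/
def projPerp (z u : E3) : E3 := u - ((‖z‖ ^ 2)⁻¹ * ⟪z, u⟫) • z

/-- `(div_v − div_{v∗}) F` for a vector field `F : ℝ³ × ℝ³ → ℝ³`. -/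
def divDiff (F : E3 × E3 → E3) (v w : E3) : ℝ :=
  LinearMap.trace ℝ E3 ((fderiv ℝ (fun z => F (z, w)) v : E3 →L[ℝ] E3) : E3 →ₗ[ℝ] E3)
    - LinearMap.trace ℝ E3 ((fderiv ℝ (fun z => F (v, z)) w : E3 →L[ℝ] E3) : E3 →ₗ[ℝ] E3)

/-- `(∇_v − ∇_{v∗})ψ` for a scalar function `ψ : ℝ³ × ℝ³ → ℝ`. -/
def gradDiff (ψ : E3 × E3 → ℝ) (q : E3 × E3) : E3 :=
  gradient (fun z => ψ (z, q.2)) q.1 - gradient (fun z => ψ (q.1, z)) q.2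

/-- Discrete gradient `∇̄ψ(v,v∗,σ) = ψ(v',v∗') + ψ(v∗',v') − ψ(v,v∗) − ψ(v∗,v)` for a
function of two velocities. -/
def barGrad2 (ψ : E3 × E3 → ℝ) (v w σ : E3) : ℝ :=
  ψ (vPost v w σ, vPostStar v w σ) + ψ (vPostStar v w σ, vPost v w σ) - ψ (v, w) - ψ (w, v)

lemma orthonormal_triple {k h i : E3} (hk : ‖k‖ = 1) (hh : ‖h‖ = 1) (hi : ‖i‖ = 1)
    (hkh : ⟪k, h⟫ = 0) (hki : ⟪k, i⟫ = 0) (hhi : ⟪h, i⟫ = 0) : Orthonormal ℝ ![k, h, i] := by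
  refine ⟨fun a => ?_, fun a b hab => ?_⟩
  · fin_cases a <;> simp [hk, hh, hi]
  · fin_cases a <;> fin_cases b <;>
      simp_all [real_inner_comm k h, real_inner_comm k i, real_inner_comm h i]

lemma norm_unitK {v w : E3} (hvw : v ≠ w) : ‖unitK v w‖ = 1 := by
  have : ‖v - w‖ ≠ 0 := norm_ne_zero_iff.2 (sub_ne_zero.2 hvw)
  rw [unitK, norm_smul, norm_inv, norm_norm, inv_mul_cancel₀ this]

lemma norm_smul_unitK (v w : E3) : ‖v - w‖ • unitK v w = v - w := by
  rcases eq_or_ne v w with rfl | hvw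
  · simp
  · have : ‖v - w‖ ≠ 0 := norm_ne_zero_iff.2 (sub_ne_zero.2 hvw)
    rw [unitK, smul_smul, mul_inv_cancel₀ this, one_smul]

lemma norm_sq_eq_of_orthonormal {k h i : E3} (ho : Orthonormal ℝ ![k, h, i]) (x : E3) :
    ‖x‖ ^ 2 = ⟪k, x⟫ ^ 2 + ⟪h, x⟫ ^ 2 + ⟪i, x⟫ ^ 2 := by
  have hcard : Fintype.card (Fin 3) = Module.finrank ℝ E3 := by simp
  have hspan := (basisOfOrthonormalOfCardEqFinrank ho hcard).span_eq
  rw [coe_basisOfOrthonormalOfCardEqFinrank] at hspan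
  have := (OrthonormalBasis.mk ho hspan.ge).sum_sq_inner_right x
  rw [Fin.sum_univ_three] at this
  simpa using this.symm

lemma norm_sigmaDir {k h i : E3} (ho : Orthonormal ℝ ![k, h, i]) (θ φ : ℝ) :
    ‖sigmaDir k h i θ φ‖ = 1 := by
  have hk : ‖k‖ = 1 := ho.1 0
  have hh : ‖h‖ = 1 := ho.1 1
  have hi : ‖i‖ = 1 := ho.1 2
  have hkh : ⟪k, h⟫ = 0 := ho.2 (show (0 : Fin 3) ≠ 1 by decide)
  have hki : ⟪k, i⟫ = 0 := ho.2 (show (0 : Fin 3) ≠ 2 by decide)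
  have hhi : ⟪h, i⟫ = 0 := ho.2 (show (1 : Fin 3) ≠ 2 by decide)
  have hsq : ‖sigmaDir k h i θ φ‖ ^ 2 = 1 := by
    rw [norm_sq_eq_of_orthonormal ho, sigmaDir]
    simp only [inner_add_right, inner_smul_right, real_inner_self_eq_norm_sq, hkh, hki, hhi,
      real_inner_comm k h, real_inner_comm k i, real_inner_comm h i, hk, hh, hi]
    have h1 := Real.sin_sq_add_cos_sq θ
    have h2 := Real.sin_sq_add_cos_sq φ
    linear_combination h1 + Real.sin θ ^ 2 * h2
  nlinarith [norm_nonneg (sigmaDir k h i θ φ)]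

lemma norm_sigmaDir_sub_le {k h i : E3} (hk : ‖k‖ = 1) (hh : ‖h‖ = 1) (hi : ‖i‖ = 1) (θ φ : ℝ) :
    ‖sigmaDir k h i θ φ - k‖ ≤ 3 * |θ| := by
  have hcos : |Real.cos θ - 1| ≤ |θ| := by simpa using Real.abs_cos_sub_cos_le θ 0
  have hsin : |Real.sin θ| ≤ |θ| := Real.abs_sin_le_abs
  have hω : ‖Real.cos φ • h + Real.sin φ • i‖ ≤ 2 := by
    refine (norm_add_le _ _).trans ?_
    rw [norm_smul, norm_smul, hh, hi, Real.norm_eq_abs, Real.norm_eq_abs]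
    linarith [Real.abs_cos_le_one φ, Real.abs_sin_le_one φ]
  have heq : sigmaDir k h i θ φ - k
      = (Real.cos θ - 1) • k + Real.sin θ • (Real.cos φ • h + Real.sin φ • i) := by
    rw [sigmaDir]; module
  rw [heq]
  refine (norm_add_le _ _).trans ?_
  rw [norm_smul, norm_smul, hk, Real.norm_eq_abs, Real.norm_eq_abs]
  nlinarith [mul_le_mul hsin hω (norm_nonneg _) (abs_nonneg θ)]

lemma hasDerivAt_sigmaDir_zero (k h i : E3) (φ : ℝ) :
    HasDerivAt (fun θ => sigmaDir k h i θ φ) (Real.cos φ • h + Real.sin φ • i) 0 := by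
  have := ((Real.hasDerivAt_cos 0).smul_const k).add
    ((Real.hasDerivAt_sin 0).smul_const (Real.cos φ • h + Real.sin φ • i))
  exact this.congr_deriv (by simp)

lemma vPost_unitK (v w : E3) : vPost v w (unitK v w) = v := by
  have : (‖v - w‖ / 2) • unitK v w = (2 : ℝ)⁻¹ • (v - w) := by
    rw [← norm_smul_unitK v w, smul_smul, norm_smul_unitK]; ring_nf
  rw [vPost, this]; module

lemma vPostStar_unitK (v w : E3) : vPostStar v w (unitK v w) = w := by
  have : (‖v - w‖ / 2) • unitK v w = (2 : ℝ)⁻¹ • (v - w) := by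
    rw [← norm_smul_unitK v w, smul_smul, norm_smul_unitK]; ring_nf
  rw [vPostStar, this]; module

lemma vPost_sub_vPostStar (v w σ : E3) : vPost v w σ - vPostStar v w σ = ‖v - w‖ • σ := by
  rw [vPost, vPostStar]; module

lemma norm_vPost_sq_add {v w σ : E3} (hσ : ‖σ‖ = 1) :
    ‖vPost v w σ‖ ^ 2 + ‖vPostStar v w σ‖ ^ 2 = ‖v‖ ^ 2 + ‖w‖ ^ 2 := by
  have h1 := parallelogram_law_with_norm ℝ ((2 : ℝ)⁻¹ • (v + w)) ((‖v - w‖ / 2) • σ)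
  have h2 := parallelogram_law_with_norm ℝ v w
  have h3 : ‖(2 : ℝ)⁻¹ • (v + w)‖ = ‖v + w‖ / 2 := by
    rw [norm_smul]; norm_num; ring
  have h4 : ‖(‖v - w‖ / 2) • σ‖ = ‖v - w‖ / 2 := by
    rw [norm_smul, hσ, mul_one, Real.norm_of_nonneg (by positivity)]
  rw [h3, h4] at h1
  rw [vPost, vPostStar]
  nlinarith

lemma barGrad2_eq {ψ : E3 × E3 → ℝ} (hs : ∀ v w : E3, ψ (v, w) = ψ (w, v)) (v w σ : E3) :
    barGrad2 ψ v w σ = 2 * (ψ (vPost v w σ, vPostStar v w σ) - ψ (v, w)) := by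
  rw [barGrad2, hs (vPostStar v w σ), hs w v]; ring

lemma barGrad2_self {ψ : E3 × E3 → ℝ} (v σ : E3) : barGrad2 ψ v v σ = 0 := by
  have h1 : vPost v v σ = v := by
    have : vPost v v σ = (2 : ℝ)⁻¹ • (v + v) := by simp [vPost]
    rw [this]; module
  have h2 : vPostStar v v σ = v := by
    have : vPostStar v v σ = (2 : ℝ)⁻¹ • (v + v) := by simp [vPostStar]
    rw [this]; module
  rw [barGrad2, h1, h2]; ring

lemma abs_barGrad2_le {ψ : E3 × E3 → ℝ} (hs : ∀ v w : E3, ψ (v, w) = ψ (w, v)) {L : NNReal}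
    (hL : LipschitzWith L ψ) {v w h i : E3} (ho : v ≠ w → Orthonormal ℝ ![unitK v w, h, i])
    (θ φ : ℝ) :
    |barGrad2 ψ v w (sigmaDir (unitK v w) h i θ φ)| ≤ 3 * L * ‖v - w‖ * |θ| := by
  rcases eq_or_ne v w with rfl | hvw
  · simp [barGrad2_self]
  have ho := ho hvw
  set σ := sigmaDir (unitK v w) h i θ φ
  have hσ : ‖σ - unitK v w‖ ≤ 3 * |θ| := norm_sigmaDir_sub_le (ho.1 0) (ho.1 1) (ho.1 2) θ φ
  have h1 : vPost v w σ - v = (‖v - w‖ / 2) • (σ - unitK v w) := by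
    nth_rewrite 2 [← vPost_unitK v w]
    rw [vPost, vPost]; module
  have h2 : vPostStar v w σ - w = -((‖v - w‖ / 2) • (σ - unitK v w)) := by
    nth_rewrite 2 [← vPostStar_unitK v w]
    rw [vPostStar, vPostStar]; module
  have h3 := hL.norm_sub_le (vPost v w σ, vPostStar v w σ) (v, w)
  rw [Prod.mk_sub_mk, Prod.norm_mk, h1, h2, norm_neg, max_self, norm_smul,
    Real.norm_of_nonneg (show 0 ≤ ‖v - w‖ / 2 by positivity)] at h3
  rw [barGrad2_eq hs, abs_mul, abs_two, ← Real.norm_eq_abs]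
  have h4 : (L : ℝ) * (‖v - w‖ / 2 * ‖σ - unitK v w‖) ≤ L * (‖v - w‖ / 2 * (3 * |θ|)) := by
    gcongr
  linarith

lemma barGrad2_eq_zero_of_le {ψ : E3 × E3 → ℝ} (hs : ∀ v w : E3, ψ (v, w) = ψ (w, v)) {δ : ℝ}
    (hδ : ∀ v w : E3, ‖v - w‖ ≤ δ → ψ (v, w) = 0) {v w h i : E3}
    (ho : v ≠ w → Orthonormal ℝ ![unitK v w, h, i]) (hvw : ‖v - w‖ ≤ δ) (θ φ : ℝ) :
    barGrad2 ψ v w (sigmaDir (unitK v w) h i θ φ) = 0 := by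
  rcases eq_or_ne v w with rfl | hne
  · exact barGrad2_self _ _
  rw [barGrad2_eq hs, hδ v w hvw, hδ, sub_zero, mul_zero]
  rwa [vPost_sub_vPostStar, norm_smul, norm_norm, norm_sigmaDir (ho hne), mul_one]

lemma barGrad2_eq_zero_of_lt {ψ : E3 × E3 → ℝ} (hs : ∀ v w : E3, ψ (v, w) = ψ (w, v)) {R : ℝ}
    (hR0 : 0 ≤ R) (hR : ∀ q : E3 × E3, R < ‖q‖ → ψ q = 0) {v w h i : E3}
    (ho : v ≠ w → Orthonormal ℝ ![unitK v w, h, i]) (hvw : 2 * R < ‖(v, w)‖) (θ φ : ℝ) :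
    barGrad2 ψ v w (sigmaDir (unitK v w) h i θ φ) = 0 := by
  rcases eq_or_ne v w with rfl | hne
  · exact barGrad2_self _ _
  rw [barGrad2_eq hs, hR (v, w) (by linarith), hR, sub_zero, mul_zero]
  have h1 := norm_vPost_sq_add (v := v) (w := w) (norm_sigmaDir (ho hne) θ φ)
  set σ := sigmaDir (unitK v w) h i θ φ
  by_contra! hle
  rw [Prod.norm_mk] at hle hvw
  obtain ⟨h2, h3⟩ := max_le_iff.1 hle
  have h4 : ‖vPost v w σ‖ ^ 2 ≤ R ^ 2 := by gcongr
  have h5 : ‖vPostStar v w σ‖ ^ 2 ≤ R ^ 2 := by gcongr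
  rcases lt_max_iff.1 hvw with h6 | h6 <;> nlinarith [sq_nonneg ‖v‖, sq_nonneg ‖w‖]

lemma inner_gradDiff {ψ : E3 × E3 → ℝ} {q : E3 × E3} (hd : DifferentiableAt ℝ ψ q) (x : E3) :
    ⟪gradDiff ψ q, x⟫ = fderiv ℝ ψ q (x, -x) := by
  have h1 : HasFDerivAt (fun z => ψ (z, q.2)) _ q.1 :=
    HasFDerivAt.comp (g := ψ) (f := fun z => (z, q.2)) q.1 hd.hasFDerivAt
      (hasFDerivAt_prodMk_left q.1 q.2)
  have h2 : HasFDerivAt (fun z => ψ (q.1, z)) _ q.2 :=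
    HasFDerivAt.comp (g := ψ) (f := fun z => (q.1, z)) q.2 hd.hasFDerivAt
      (hasFDerivAt_prodMk_right q.1 q.2)
  rw [gradDiff, inner_sub_left, inner_gradient_left, inner_gradient_left, h1.fderiv, h2.fderiv]
  simp only [ContinuousLinearMap.comp_apply, ContinuousLinearMap.inl_apply,
    ContinuousLinearMap.inr_apply, ← map_sub]
  simp

lemma hasDerivAt_barGrad2 {ψ : E3 × E3 → ℝ} (hs : ∀ v w : E3, ψ (v, w) = ψ (w, v))
    {v w : E3} (hd : DifferentiableAt ℝ ψ (v, w)) (h i : E3) (φ : ℝ) :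
    HasDerivAt (fun θ => barGrad2 ψ v w (sigmaDir (unitK v w) h i θ φ))
      (‖v - w‖ * ⟪gradDiff ψ (v, w), Real.cos φ • h + Real.sin φ • i⟫) 0 := by
  set ω := Real.cos φ • h + Real.sin φ • i with hω
  have hσ0 : sigmaDir (unitK v w) h i 0 φ = unitK v w := by simp [sigmaDir]
  have hσ := (hasDerivAt_sigmaDir_zero (unitK v w) h i φ).const_smul (‖v - w‖ / 2)
  have h1 := (hσ.const_add ((2 : ℝ)⁻¹ • (v + w))).prodMk (hσ.const_sub ((2 : ℝ)⁻¹ • (v + w)))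
  have hp : (v, w) = (vPost v w (sigmaDir (unitK v w) h i 0 φ),
      vPostStar v w (sigmaDir (unitK v w) h i 0 φ)) := by
    rw [hσ0, vPost_unitK, vPostStar_unitK]
  have hd' := hd.hasFDerivAt
  have h2 : HasDerivAt (fun θ => ψ (vPost v w (sigmaDir (unitK v w) h i θ φ),
      vPostStar v w (sigmaDir (unitK v w) h i θ φ)))
      (fderiv ℝ ψ (v, w) ((‖v - w‖ / 2) • ω, -((‖v - w‖ / 2) • ω))) 0 :=
    HasFDerivAt.comp_hasDerivAt_of_eq (0 : ℝ) hd' h1 hp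
  simp only [barGrad2_eq hs]
  refine ((h2.sub_const (ψ (v, w))).const_mul 2).congr_deriv ?_
  rw [← inner_gradDiff hd, inner_smul_right]
  ring

lemma setIntegral_sq_cos_add_sin (a b : ℝ) :
    ∫ φ in Set.Ioc (0 : ℝ) (2 * π), (Real.cos φ * a + Real.sin φ * b) ^ 2
      = π * (a ^ 2 + b ^ 2) := by
  rw [← intervalIntegral.integral_of_le (by positivity)]
  have : ∀ φ : ℝ, (Real.cos φ * a + Real.sin φ * b) ^ 2
      = a ^ 2 * Real.cos φ ^ 2 + (2 * a * b) * (Real.sin φ * Real.cos φ)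
        + b ^ 2 * Real.sin φ ^ 2 := fun φ => by ring
  simp only [this]
  rw [intervalIntegral.integral_add, intervalIntegral.integral_add,
    intervalIntegral.integral_const_mul, intervalIntegral.integral_const_mul,
    intervalIntegral.integral_const_mul, integral_cos_sq, integral_sin_sq, integral_sin_mul_cos₁]
  · simp; ring
  all_goals exact Continuous.intervalIntegrable (by fun_prop) _ _

lemma norm_projPerp_sq {v w h i : E3} (hvw : v ≠ w) (ho : Orthonormal ℝ ![unitK v w, h, i])
    (x : E3) : ‖projPerp (v - w) x‖ ^ 2 = ⟪h, x⟫ ^ 2 + ⟪i, x⟫ ^ 2 := by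
  have hz : ‖v - w‖ ≠ 0 := norm_ne_zero_iff.2 (sub_ne_zero.2 hvw)
  have hk : ‖unitK v w‖ = 1 := ho.1 0
  have hkh : ⟪unitK v w, h⟫ = 0 := ho.2 (show (0 : Fin 3) ≠ 1 by decide)
  have hki : ⟪unitK v w, i⟫ = 0 := ho.2 (show (0 : Fin 3) ≠ 2 by decide)
  have hp : projPerp (v - w) x = x - ⟪unitK v w, x⟫ • unitK v w := by
    rw [projPerp, unitK, inner_smul_left, smul_smul]
    congr 2
    simp only [conj_trivial]
    ring
  rw [hp, norm_sq_eq_of_orthonormal ho]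
  simp only [inner_sub_right, inner_smul_right, real_inner_self_eq_norm_sq, hk,
    real_inner_comm (unitK v w) h, real_inner_comm (unitK v w) i, hkh, hki]
  ring

/-- The squared discrete gradient integrated over the azimuthal angle. -/
def azimuthalSq (ψ : E3 × E3 → ℝ) (h i : E3 × E3 → E3) (q : E3 × E3) (θ : ℝ) : ℝ :=
  ∫ φ in Set.Ioc (0:ℝ) (2 * π),
    (barGrad2 ψ q.1 q.2 (sigmaDir (unitK q.1 q.2) (h q) (i q) θ φ)) ^ 2

lemma measurable_barGrad2 {ψ : E3 × E3 → ℝ} (hψ : Measurable ψ) {h i : E3 × E3 → E3}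
    (hh : Measurable h) (hi : Measurable i) :
    Measurable fun p : ((E3 × E3) × ℝ) × ℝ =>
      barGrad2 ψ p.1.1.1 p.1.1.2
        (sigmaDir (unitK p.1.1.1 p.1.1.2) (h p.1.1) (i p.1.1) p.1.2 p.2) := by
  unfold barGrad2 vPost vPostStar sigmaDir unitK
  fun_prop

lemma measurable_azimuthalSq {ψ : E3 × E3 → ℝ} (hψ : Measurable ψ) {h i : E3 × E3 → E3}
    (hh : Measurable h) (hi : Measurable i) :
    Measurable fun p : (E3 × E3) × ℝ => azimuthalSq ψ h i p.1 p.2 :=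
  (((measurable_barGrad2 hψ hh hi).pow_const 2).stronglyMeasurable.integral_prod_right').measurable

lemma azimuthalSq_nonneg (ψ : E3 × E3 → ℝ) (h i : E3 × E3 → E3) (q : E3 × E3) (θ : ℝ) :
    0 ≤ azimuthalSq ψ h i q θ :=
  integral_nonneg fun _ => sq_nonneg _

lemma azimuthalSq_le {ψ : E3 × E3 → ℝ} (hs : ∀ v w : E3, ψ (v, w) = ψ (w, v)) {L : NNReal}
    (hL : LipschitzWith L ψ) {h i : E3 × E3 → E3} {q : E3 × E3}
    (ho : q.1 ≠ q.2 → Orthonormal ℝ ![unitK q.1 q.2, h q, i q]) (θ : ℝ) :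
    azimuthalSq ψ h i q θ ≤ 2 * π * (3 * L * ‖q.1 - q.2‖) ^ 2 * θ ^ 2 := by
  have h1 : ∀ φ ∈ Set.Ioc (0:ℝ) (2 * π),
      ‖(barGrad2 ψ q.1 q.2 (sigmaDir (unitK q.1 q.2) (h q) (i q) θ φ)) ^ 2‖
        ≤ (3 * L * ‖q.1 - q.2‖ * |θ|) ^ 2 := fun φ _ => by
    rw [norm_pow, Real.norm_eq_abs]
    gcongr
    exact abs_barGrad2_le hs hL ho θ φ
  have h2 := norm_setIntegral_le_of_norm_le_const (μ := volume) measure_Ioc_lt_top h1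
  rw [Real.volume_real_Ioc_of_le (by positivity), mul_pow, sq_abs] at h2
  exact (le_abs_self _).trans (h2.trans_eq (by ring))

lemma measurable_barGrad2_sigmaDir {ψ : E3 × E3 → ℝ} (hψ : Measurable ψ) (v w k h i : E3)
    (θ : ℝ) : Measurable fun φ : ℝ => barGrad2 ψ v w (sigmaDir k h i θ φ) := by
  unfold barGrad2 vPost vPostStar sigmaDir
  fun_prop

lemma tendsto_azimuthalSq {ψ : E3 × E3 → ℝ} (hs : ∀ v w : E3, ψ (v, w) = ψ (w, v)) {L : NNReal}
    (hL : LipschitzWith L ψ) (hd : Differentiable ℝ ψ) {h i : E3 × E3 → E3}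
    {q : E3 × E3} (ho : q.1 ≠ q.2 → Orthonormal ℝ ![unitK q.1 q.2, h q, i q]) :
    Tendsto (fun θ => (θ ^ 2)⁻¹ * azimuthalSq ψ h i q θ) (𝓝[>] 0)
      (𝓝 (π * (‖q.1 - q.2‖ ^ 2 * ‖projPerp (q.1 - q.2) (gradDiff ψ q)‖ ^ 2))) := by
  rcases eq_or_ne q.1 q.2 with heq | hne
  · have : ∀ θ, azimuthalSq ψ h i q θ = 0 := fun θ => by
      simp [azimuthalSq, heq, barGrad2_self]
    simp [this, heq]
  have hlim : ∫ φ in Set.Ioc (0:ℝ) (2 * π),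
      (‖q.1 - q.2‖ * ⟪gradDiff ψ q, Real.cos φ • h q + Real.sin φ • i q⟫) ^ 2
        = π * (‖q.1 - q.2‖ ^ 2 * ‖projPerp (q.1 - q.2) (gradDiff ψ q)‖ ^ 2) := by
    rw [norm_projPerp_sq hne (ho hne), real_inner_comm, real_inner_comm (gradDiff ψ q) (i q)]
    simp only [mul_pow, inner_add_right, inner_smul_right]
    rw [integral_const_mul, setIntegral_sq_cos_add_sin]
    ring
  rw [← hlim]
  simp only [azimuthalSq, ← integral_const_mul]
  have hmeas : ∀ θ : ℝ, Measurable fun φ : ℝ =>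
      barGrad2 ψ q.1 q.2 (sigmaDir (unitK q.1 q.2) (h q) (i q) θ φ) := fun θ =>
    measurable_barGrad2_sigmaDir hL.continuous.measurable _ _ _ _ _ θ
  apply tendsto_integral_filter_of_dominated_convergence
    (fun _ => (3 * L * ‖q.1 - q.2‖) ^ 2)
  rotate_left 2
  · exact integrable_const _
  rotate_left
  · exact Eventually.of_forall fun θ =>
      (((hmeas θ).pow_const 2).const_mul _).aestronglyMeasurable
  · filter_upwards [self_mem_nhdsWithin] with θ hθ
    refine Eventually.of_forall fun φ => ?_
    have hθ : 0 < θ := hθ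
    have h1 := abs_barGrad2_le hs hL ho θ φ
    rw [norm_mul, norm_pow, Real.norm_eq_abs, Real.norm_eq_abs, abs_of_pos (by positivity),
      inv_mul_le_iff₀ (by positivity), ← mul_pow, mul_comm θ]
    rw [abs_of_pos hθ] at h1
    gcongr
  · refine Eventually.of_forall fun φ => ?_
    have h1 := (hasDerivAt_iff_tendsto_slope.1
      (hasDerivAt_barGrad2 hs (hd (q.1, q.2)) (h q) (i q) φ)).mono_left
        (nhdsWithin_mono 0 fun x (hx : 0 < x) => hx.ne')
    refine (h1.pow 2).congr fun θ => ?_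
    have h0 : barGrad2 ψ q.1 q.2 (sigmaDir (unitK q.1 q.2) (h q) (i q) 0 φ) = 0 := by
      have hσ0 : sigmaDir (unitK q.1 q.2) (h q) (i q) 0 φ = unitK q.1 q.2 := by simp [sigmaDir]
      rw [barGrad2_eq hs, hσ0, vPost_unitK, vPostStar_unitK, sub_self, mul_zero]
    rw [slope_def_field, h0, sub_zero, sub_zero, div_pow, div_eq_inv_mul]

lemma setIntegral_grazing_rescale (β F : ℝ → ℝ) {ε : ℝ} (hε : 0 < ε) :
    ∫ θ in Set.Ioc (0:ℝ) (ε / 2), (π ^ 3 / ε ^ 3) * β (π * θ / ε) * F θ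
      = ∫ s in Set.Ioc (0:ℝ) (π / 2),
          s ^ 2 * β s * (((ε / π * s) ^ 2)⁻¹ * F (ε / π * s)) := by
  have hπ := Real.pi_pos
  have hc : ε / π ≠ 0 := by positivity
  have h1 := intervalIntegral.integral_comp_mul_left (a := 0) (b := π / 2)
    (fun θ => (π ^ 3 / ε ^ 3) * β (π * θ / ε) * F θ) hc
  have h2 : ε / π * (π / 2) = ε / 2 := by field_simp
  rw [mul_zero, h2, smul_eq_mul, eq_inv_mul_iff_mul_eq₀ hc,
    intervalIntegral.integral_of_le (by positivity),
    intervalIntegral.integral_of_le (by positivity)] at h1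
  rw [← h1, ← integral_const_mul]
  refine setIntegral_congr_fun measurableSet_Ioc fun s hs => ?_
  have hs0 : s ≠ 0 := hs.1.ne'
  have h3 : π * (ε / π * s) / ε = s := by field_simp
  simp only [h3]
  field_simp

section Weighted

variable {w : ℝ → ℝ} {b : ℝ}

lemma abs_setIntegral_weight_mul_le (hw : IntegrableOn w (Set.Ioc 0 b))
    (hw0 : ∀ s, 0 ≤ w s) {G : ℝ → ℝ} {B c : ℝ} (hc : 0 < c) (hG : ∀ θ, 0 < θ → |G θ| ≤ B) :
    |∫ s in Set.Ioc (0:ℝ) b, w s * G (c * s)| ≤ (∫ s in Set.Ioc (0:ℝ) b, w s) * B := by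
  rw [← integral_mul_const, ← Real.norm_eq_abs]
  refine norm_integral_le_of_norm_le (hw.mul_const B) ?_
  refine (ae_restrict_mem measurableSet_Ioc).mono fun s hs => ?_
  rw [norm_mul, Real.norm_of_nonneg (hw0 s)]
  exact mul_le_mul_of_nonneg_left (hG _ (mul_pos hc hs.1)) (hw0 s)

lemma tendsto_setIntegral_weight_mul (hw : IntegrableOn w (Set.Ioc 0 b))
    (hw0 : ∀ s, 0 ≤ w s) {G : ℝ → ℝ} (hGm : Measurable G) {B l a : ℝ} (ha : 0 < a)
    (hG : ∀ θ, 0 < θ → |G θ| ≤ B) (hlim : Tendsto G (𝓝[>] 0) (𝓝 l)) :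
    Tendsto (fun ε : ℝ => ∫ s in Set.Ioc (0:ℝ) b, w s * G (ε / a * s)) (𝓝[>] 0)
      (𝓝 ((∫ s in Set.Ioc (0:ℝ) b, w s) * l)) := by
  rw [← integral_mul_const]
  apply tendsto_integral_filter_of_dominated_convergence (fun s => w s * B)
  · exact Eventually.of_forall fun ε => hw.aestronglyMeasurable.mul
      (hGm.comp (measurable_const_mul (ε / a))).aestronglyMeasurable
  · filter_upwards [self_mem_nhdsWithin] with ε hε
    refine (ae_restrict_mem measurableSet_Ioc).mono fun s hs => ?_
    rw [norm_mul, Real.norm_of_nonneg (hw0 s)]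
    exact mul_le_mul_of_nonneg_left (hG _ (mul_pos (div_pos hε ha) hs.1)) (hw0 s)
  · exact hw.mul_const B
  · refine (ae_restrict_mem measurableSet_Ioc).mono fun s hs => ?_
    refine (hlim.comp (tendsto_nhdsWithin_iff.2 ⟨?_, ?_⟩)).const_mul (w s)
    · have : Tendsto (fun ε : ℝ => ε / a * s) (𝓝 0) (𝓝 (0 / a * s)) :=
        (by fun_prop : Continuous fun ε : ℝ => ε / a * s).tendsto 0
      rw [zero_div, zero_mul] at this
      exact this.mono_left nhdsWithin_le_nhds
    · filter_upwards [self_mem_nhdsWithin] with ε hε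
      exact mul_pos (div_pos hε ha) hs.1

end Weighted

lemma azimuthalSq_eq_zero_of_le {ψ : E3 × E3 → ℝ} (hs : ∀ v w : E3, ψ (v, w) = ψ (w, v))
    {δ : ℝ} (hδ : ∀ v w : E3, ‖v - w‖ ≤ δ → ψ (v, w) = 0) {h i : E3 × E3 → E3} {q : E3 × E3}
    (ho : q.1 ≠ q.2 → Orthonormal ℝ ![unitK q.1 q.2, h q, i q]) (hq : ‖q.1 - q.2‖ ≤ δ) (θ : ℝ) :
    azimuthalSq ψ h i q θ = 0 := by
  simp [azimuthalSq, barGrad2_eq_zero_of_le hs hδ ho hq]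

lemma azimuthalSq_eq_zero_of_lt {ψ : E3 × E3 → ℝ} (hs : ∀ v w : E3, ψ (v, w) = ψ (w, v))
    {R : ℝ} (hR0 : 0 ≤ R) (hR : ∀ q : E3 × E3, R < ‖q‖ → ψ q = 0) {h i : E3 × E3 → E3}
    {q : E3 × E3} (ho : q.1 ≠ q.2 → Orthonormal ℝ ![unitK q.1 q.2, h q, i q])
    (hq : 2 * R < ‖q‖) (θ : ℝ) : azimuthalSq ψ h i q θ = 0 := by
  simp [azimuthalSq, barGrad2_eq_zero_of_lt hs hR0 hR ho (show 2 * R < ‖(q.1, q.2)‖ from hq)]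

lemma gradDiff_eq_zero_of_self {ψ : E3 × E3 → ℝ} {δ : ℝ} (hδ0 : 0 < δ)
    (hδ : ∀ v w : E3, ‖v - w‖ ≤ δ → ψ (v, w) = 0) (v : E3) : gradDiff ψ (v, v) = 0 := by
  have hball : ∀ᶠ z in 𝓝 v, ‖z - v‖ < δ := by
    filter_upwards [Metric.ball_mem_nhds v hδ0] with z hz using mem_ball_iff_norm.1 hz
  have h1 : (fun z => ψ (z, v)) =ᶠ[𝓝 v] fun _ => 0 :=
    hball.mono fun z hz => hδ z v hz.le
  have h2 : (fun z => ψ (v, z)) =ᶠ[𝓝 v] fun _ => 0 :=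
    hball.mono fun z hz => hδ v z (by rw [norm_sub_rev]; exact hz.le)
  simp [gradDiff, gradient, h1.fderiv_eq, h2.fderiv_eq]

lemma rpow_mul_sq_mul_projPerp {ψ : E3 × E3 → ℝ} {δ : ℝ} (hδ0 : 0 < δ)
    (hδ : ∀ v w : E3, ‖v - w‖ ≤ δ → ψ (v, w) = 0) (γ : ℝ) (q : E3 × E3) :
    ‖q.1 - q.2‖ ^ γ * (‖q.1 - q.2‖ ^ 2 * ‖projPerp (q.1 - q.2) (gradDiff ψ q)‖ ^ 2)
      = ‖q.1 - q.2‖ ^ (2 + γ) * ‖projPerp (q.1 - q.2) (gradDiff ψ q)‖ ^ 2 := by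
  obtain ⟨v, w⟩ := q
  rcases eq_or_ne v w with rfl | hne
  · simp [gradDiff_eq_zero_of_self hδ0 hδ, projPerp]
  · have hz : 0 < ‖v - w‖ := norm_pos_iff.2 (sub_ne_zero.2 hne)
    rw [Real.rpow_add hz, Real.rpow_two]
    ring

/-- Grazing collision limit of the quadratic discrete-gradient term: for
`ψ ∈ DS_c^∞` (smooth, compactly supported, symmetric, vanishing near the diagonal),
`∫∫ |v−v∗|^γ ∫₀^{ε/2} β^ε ∫₀^{2π} |∇̄ψ|² dφ dθ dv∗ dv` converges, as `ε ↓ 0`, to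
`8 ∫∫ |v−v∗|^{2+γ} |Π[v−v∗]((∇_v − ∇_{v∗})ψ)|² dv∗ dv`. -/
theorem grazing_limit_of_squared_discrete_gradient
    (γ : ℝ) (hγ : γ ∈ Set.Ico (-4 : ℝ) 0)
    (β : ℝ → ℝ) (hβm : Measurable β) (hβ0 : ∀ θ, 0 ≤ β θ)
    (hβnorm : ∫ θ in Set.Ioc (0:ℝ) (π / 2), θ ^ 2 * β θ = 8 / π)
    (ψ : E3 × E3 → ℝ) (hψ : ContDiff ℝ (⊤ : ℕ∞) ψ) (hψc : HasCompactSupport ψ)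
    (hψsymm : ∀ v w : E3, ψ (v, w) = ψ (w, v))
    (hψdiag : ∃ δ > 0, ∀ v w : E3, ‖v - w‖ ≤ δ → ψ (v, w) = 0)
    (h i : E3 × E3 → E3) (hhm : Measurable h) (him : Measurable i)
    (honb : ∀ v w : E3, v ≠ w →
      ‖h (v, w)‖ = 1 ∧ ‖i (v, w)‖ = 1 ∧
        ⟪unitK v w, h (v, w)⟫ = 0 ∧ ⟪unitK v w, i (v, w)⟫ = 0 ∧
        ⟪h (v, w), i (v, w)⟫ = 0) :
    Filter.Tendsto (fun ε : ℝ =>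
        ∫ q : E3 × E3, ‖q.1 - q.2‖ ^ γ *
          ∫ θ in Set.Ioc (0:ℝ) (ε / 2), (π ^ 3 / ε ^ 3) * β (π * θ / ε) *
            ∫ φ in Set.Ioc (0:ℝ) (2 * π),
              (barGrad2 ψ q.1 q.2 (sigmaDir (unitK q.1 q.2) (h q) (i q) θ φ)) ^ 2)
      (𝓝[>] (0 : ℝ))
      (𝓝 (8 * ∫ q : E3 × E3,
        ‖q.1 - q.2‖ ^ (2 + γ) * ‖projPerp (q.1 - q.2) (gradDiff ψ q)‖ ^ 2)) := by
  have hπ := Real.pi_pos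
  obtain ⟨δ, hδ0, hδ⟩ := hψdiag
  obtain ⟨L, hL⟩ := hψ.lipschitzWith_of_hasCompactSupport hψc (by simp)
  have hd : Differentiable ℝ ψ := hψ.differentiable (by simp)
  obtain ⟨R, hR0, hR⟩ : ∃ R, 0 ≤ R ∧ ∀ q : E3 × E3, R < ‖q‖ → ψ q = 0 := by
    obtain ⟨R, hR⟩ := hψc.isCompact.isBounded.exists_norm_le
    refine ⟨max R 0, le_max_right _ _, fun q hq => image_eq_zero_of_notMem_tsupport fun hmem => ?_⟩
    exact absurd (hR q hmem) (not_le.2 ((le_max_left _ _).trans_lt hq))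
  have ho : ∀ q : E3 × E3, q.1 ≠ q.2 → Orthonormal ℝ ![unitK q.1 q.2, h q, i q] := fun q hq => by
    obtain ⟨h1, h2, h3, h4, h5⟩ := honb q.1 q.2 hq
    exact orthonormal_triple (norm_unitK hq) h1 h2 h3 h4 h5
  set w : ℝ → ℝ := fun s => s ^ 2 * β s with hw_def
  have hw0 : ∀ s, 0 ≤ w s := fun s => mul_nonneg (sq_nonneg s) (hβ0 s)
  have hw : IntegrableOn w (Set.Ioc 0 (π / 2)) := by
    by_contra hn
    rw [integral_undef hn] at hβnorm
    exact (by positivity : (8 / π : ℝ) ≠ 0) hβnorm.symm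
  set G : E3 × E3 → ℝ → ℝ := fun q θ => (θ ^ 2)⁻¹ * azimuthalSq ψ h i q θ with hG_def
  have hGm : Measurable fun p : (E3 × E3) × ℝ => G p.1 p.2 :=
    (measurable_snd.pow_const 2).inv.mul (measurable_azimuthalSq hL.continuous.measurable hhm him)
  have hGle : ∀ q θ, 0 < θ → |G q θ| ≤ 2 * π * (3 * L * ‖q.1 - q.2‖) ^ 2 := fun q θ hθ => by
    rw [abs_of_nonneg (mul_nonneg (by positivity) (azimuthalSq_nonneg ψ h i q θ)),
      inv_mul_le_iff₀ (by positivity), mul_comm (θ ^ 2)]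
    exact azimuthalSq_le hψsymm hL (ho q) θ
  have hlimit : 8 * ∫ q : E3 × E3,
        ‖q.1 - q.2‖ ^ (2 + γ) * ‖projPerp (q.1 - q.2) (gradDiff ψ q)‖ ^ 2
      = ∫ q : E3 × E3, ‖q.1 - q.2‖ ^ γ * ((∫ s in Set.Ioc (0:ℝ) (π / 2), w s) *
        (π * (‖q.1 - q.2‖ ^ 2 * ‖projPerp (q.1 - q.2) (gradDiff ψ q)‖ ^ 2))) := by
    rw [hβnorm, ← integral_const_mul]
    congr 1 with q
    rw [← rpow_mul_sq_mul_projPerp hδ0 hδ]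
    field_simp
  have hrescale : (fun ε : ℝ => ∫ q : E3 × E3, ‖q.1 - q.2‖ ^ γ *
        ∫ s in Set.Ioc (0:ℝ) (π / 2), w s * G q (ε / π * s)) =ᶠ[𝓝[>] 0]
      (fun ε : ℝ =>
        ∫ q : E3 × E3, ‖q.1 - q.2‖ ^ γ *
          ∫ θ in Set.Ioc (0:ℝ) (ε / 2), (π ^ 3 / ε ^ 3) * β (π * θ / ε) *
            ∫ φ in Set.Ioc (0:ℝ) (2 * π),
              (barGrad2 ψ q.1 q.2 (sigmaDir (unitK q.1 q.2) (h q) (i q) θ φ)) ^ 2) := by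
    filter_upwards [self_mem_nhdsWithin] with ε hε
    congr 1 with q
    congr 1
    exact (setIntegral_grazing_rescale β (azimuthalSq ψ h i q) hε).symm
  rw [hlimit]
  refine Tendsto.congr' hrescale ?_
  apply tendsto_integral_filter_of_dominated_convergence
    ((Metric.closedBall (0 : E3 × E3) (2 * R)).indicator fun _ =>
      δ ^ γ * (8 / π * (2 * π * (3 * L * (4 * R)) ^ 2)))
  · refine Eventually.of_forall fun ε => Measurable.aestronglyMeasurable ?_
    refine ((measurable_fst.sub measurable_snd).norm.pow_const γ).mul ?_
    have : Measurable fun p : (E3 × E3) × ℝ => w p.2 * G p.1 (ε / π * p.2) :=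
      (((measurable_id.pow_const 2).mul hβm).comp measurable_snd).mul
        (hGm.comp (measurable_fst.prodMk (measurable_snd.const_mul (ε / π))))
    exact this.stronglyMeasurable.integral_prod_right'.measurable
  · filter_upwards [self_mem_nhdsWithin] with ε hε
    refine Eventually.of_forall fun q => ?_
    by_cases hq : ‖q‖ ≤ 2 * R
    swap
    · have hz : ∀ θ, G q θ = 0 := fun θ => by
        simp [hG_def, azimuthalSq_eq_zero_of_lt hψsymm hR0 hR (ho q) (not_le.1 hq)]
      simp only [hz, mul_zero, integral_zero, norm_zero]
      exact Set.indicator_nonneg (fun _ _ => by positivity) q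
    rw [Set.indicator_of_mem (by simpa using hq)]
    by_cases hqδ : ‖q.1 - q.2‖ ≤ δ
    · have hz : ∀ θ, G q θ = 0 := fun θ => by
        simp [hG_def, azimuthalSq_eq_zero_of_le hψsymm hδ (ho q) hqδ]
      simp only [hz, mul_zero, integral_zero, norm_zero]
      positivity
    have hqδ' := not_le.1 hqδ
    have h4R : ‖q.1 - q.2‖ ≤ 4 * R := by
      have := norm_sub_le q.1 q.2
      have := norm_fst_le q
      have := norm_snd_le q
      linarith
    rw [norm_mul, Real.norm_of_nonneg (by positivity), Real.norm_eq_abs]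
    have hint := abs_setIntegral_weight_mul_le hw hw0 (div_pos hε hπ) (hGle q)
    rw [hβnorm] at hint
    refine mul_le_mul (Real.rpow_le_rpow_of_nonpos hδ0 hqδ'.le hγ.2.le) (hint.trans ?_)
      (abs_nonneg _) (by positivity)
    gcongr
  · exact (integrable_indicator_iff measurableSet_closedBall).2
      (integrableOn_const (isCompact_closedBall _ _).measure_lt_top.ne)
  · refine Eventually.of_forall fun q => ?_
    exact (tendsto_setIntegral_weight_mul hw hw0 (hGm.comp measurable_prodMk_left) hπ (hGle q)
      (tendsto_azimuthalSq hψsymm hL hd (ho q))).const_mul _
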